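/- Let π be a finite projective plane of order q with q ≥ 2. Then the number of embeddings of the complete bipartite graph K_{q-1,q} into π equals q²(q+1)(q²+q+1) · (q-1)! · q!. -/

import Mathlib

/-- `φ : V → P` is an embedding of the graph `G` into the projective plane with
points `P` and lines `L`. -/
def IsGraphEmbedding {V : Type*} (G : SimpleGraph V) (P L : Type*) [Membership P L]
    (φ : V → P) : Prop :=
  Function.Injective φ ∧
    ∀ e₁ ∈ G.edgeSet, ∀ e₂ ∈ G.edgeSet, ∀ ℓ : L,
      (∀ v ∈ e₁, φ v ∈ ℓ) → (∀ v ∈ e₂, φ v ∈ ℓ) → e₁ = e₂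

section Counting

open Configuration HasLines HasPoints Nondegenerate

variable {P L : Type*} [Membership P L]

/-- Embeddings of a complete bipartite graph, in terms of its vertices. -/
theorem isGraphEmbedding_completeBipartiteGraph_iff {α β : Type*} (φ : α ⊕ β → P) :
    IsGraphEmbedding (completeBipartiteGraph α β) P L φ ↔ Function.Injective φ ∧
      ∀ i j i' j' (ℓ : L), φ (.inl i) ∈ ℓ → φ (.inr j) ∈ ℓ → φ (.inl i') ∈ ℓ →
        φ (.inr j') ∈ ℓ → i = i' ∧ j = j' := by
  refine and_congr_right fun _ => ⟨fun h i j i' j' ℓ h₁ h₂ h₃ h₄ => ?_, fun h => ?_⟩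
  · have := h s(.inl i, .inr j) (by simp) s(.inl i', .inr j') (by simp) ℓ
      (by simp [h₁, h₂]) (by simp [h₃, h₄])
    simpa using this
  · have key : ∀ e ∈ (completeBipartiteGraph α β).edgeSet,
        ∃ i j, e = s(Sum.inl i, Sum.inr j) := by
      intro e
      induction e with
      | _ x y =>
        rcases x with i | i <;> rcases y with j | j
        · simp
        · exact fun _ => ⟨i, j, rfl⟩
        · exact fun _ => ⟨j, i, Sym2.eq_swap⟩
        · simp
    intro e₁ he₁ e₂ he₂ ℓ h₁ h₂
    obtain ⟨i, j, rfl⟩ := key e₁ he₁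
    obtain ⟨i', j', rfl⟩ := key e₂ he₂
    obtain ⟨rfl, rfl⟩ := h i j i' j' ℓ (h₁ _ (by simp)) (h₁ _ (by simp)) (h₂ _ (by simp))
      (h₂ _ (by simp))
    rfl

theorem line_eq_of_mem [Nondegenerate P L] {p p' : P} {l l' : L} (hp : p ≠ p') (h₁ : p ∈ l)
    (h₂ : p' ∈ l) (h₃ : p ∈ l') (h₄ : p' ∈ l') : l = l' :=
  (eq_or_eq h₁ h₂ h₃ h₄).resolve_left hp

variable [Fintype P] [Fintype L] [ProjectivePlane P L]

open Classical in
theorem card_filter_mem_line (l : L) :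
    (Finset.univ.filter fun p : P => p ∈ l).card = ProjectivePlane.order P L + 1 := by
  rw [← ProjectivePlane.pointCount_eq P l, pointCount, Nat.card_eq_fintype_card,
    Fintype.card_subtype]

open Classical in
theorem card_filter_line_mem (p : P) :
    (Finset.univ.filter fun l : L => p ∈ l).card = ProjectivePlane.order P L + 1 := by
  rw [← ProjectivePlane.lineCount_eq L p, lineCount, Nat.card_eq_fintype_card,
    Fintype.card_subtype]

/-- Removing a second line from a line leaves `order P L` points. -/
theorem card_mem_notMem {r m : L} (h : r ≠ m) :
    Nat.card {x : P // x ∈ r ∧ x ∉ m} = ProjectivePlane.order P L := by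
  classical
  rw [Nat.card_eq_fintype_card, Fintype.card_subtype]
  have hx := mkPoint_ax (P := P) h
  have : (Finset.univ.filter fun x : P => x ∈ r ∧ x ∉ m) =
      (Finset.univ.filter fun x : P => x ∈ r).erase (mkPoint h) := by
    ext x
    simp only [Finset.mem_filter, Finset.mem_univ, true_and, Finset.mem_erase]
    constructor
    · rintro ⟨h₁, h₂⟩
      exact ⟨fun e => h₂ (e ▸ hx.2), h₁⟩
    · rintro ⟨h₁, h₂⟩
      exact ⟨h₂, fun h₃ => h (line_eq_of_mem h₁ h₂ hx.1 h₃ hx.2)⟩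
  rw [this, Finset.card_erase_of_mem (by simp [hx.1]), card_filter_mem_line]
  rfl

/-- If `b` has `order P L` points, each joined to `a` by a different line, then exactly one line
through `a` avoids `b`. -/
theorem existsUnique_line_avoiding {β : Type*} [Fintype β]
    (hβ : Fintype.card β = ProjectivePlane.order P L) {a : P} {b : β → P}
    (hab : ∀ j, a ≠ b j) (h : ∀ j j' (ℓ : L), a ∈ ℓ → b j ∈ ℓ → b j' ∈ ℓ → j = j') :
    ∃! r : L, a ∈ r ∧ ∀ j, b j ∉ r := by
  classical
  let f : β → L := fun j => mkLine (hab j)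
  have hf : ∀ j, a ∈ f j ∧ b j ∈ f j := fun j => mkLine_ax (hab j)
  have hinj : Function.Injective f := fun j j' e =>
    h j j' (f j) (hf j).1 (hf j).2 (e ▸ (hf j').2)
  have hcard : ((Finset.univ.filter fun l : L => a ∈ l) \ Finset.univ.image f).card = 1 := by
    rw [Finset.card_sdiff_of_subset, card_filter_line_mem, Finset.card_image_of_injective _ hinj,
      Finset.card_univ, hβ]
    · omega
    · intro l
      simp only [Finset.mem_image, Finset.mem_univ, true_and, Finset.mem_filter]
      rintro ⟨j, rfl⟩
      exact (hf j).1
  have hmem : ∀ l, l ∈ (Finset.univ.filter fun l : L => a ∈ l) \ Finset.univ.image f ↔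
      a ∈ l ∧ ∀ j, b j ∉ l := by
    intro l
    simp only [Finset.mem_sdiff, Finset.mem_image, Finset.mem_univ, true_and, Finset.mem_filter,
      not_exists]
    refine and_congr_right fun hl => forall_congr' fun j => not_congr ⟨?_, fun hb => ?_⟩
    · rintro rfl
      exact (hf j).2
    · exact line_eq_of_mem (hab j) (hf j).1 (hf j).2 hl hb
  obtain ⟨r, hr⟩ := Finset.card_eq_one.mp hcard
  refine ⟨r, (hmem r).1 (by simp [hr]), fun l hl => ?_⟩
  simpa [hr] using (hmem l).2 hl

/-- An embedded `K_{q-1,q}` lives on two lines, each class avoiding their intersection. -/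
theorem exists_lines_of_embedding {α β : Type*} [Fintype α] [Fintype β] [Nonempty α]
    (hα : Fintype.card α + 1 = ProjectivePlane.order P L)
    (hβ : Fintype.card β = ProjectivePlane.order P L) {a : α → P} {b : β → P}
    (ha : Function.Injective a) (hb : Function.Injective b) (hab : ∀ i j, a i ≠ b j)
    (h : ∀ i j i' j' (ℓ : L), a i ∈ ℓ → b j ∈ ℓ → a i' ∈ ℓ → b j' ∈ ℓ → i = i' ∧ j = j') :
    ∃ r m : L, (∀ i, a i ∈ r ∧ a i ∉ m) ∧ ∀ j, b j ∈ m ∧ b j ∉ r := by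
  classical
  obtain ⟨i₀⟩ := ‹Nonempty α›
  obtain ⟨r, ⟨hr₀, hbr⟩, hr⟩ := existsUnique_line_avoiding hβ (hab i₀)
    fun j j' ℓ h₁ h₂ h₃ => (h i₀ j i₀ j' ℓ h₁ h₂ h₁ h₃).2
  have har : ∀ i, a i ∈ r := by
    intro i
    by_cases hi : i₀ = i
    · exact hi ▸ hr₀
    have hne := ha.ne hi
    have hl := mkLine_ax (L := L) hne
    have := hr (mkLine hne) ⟨hl.1, fun j hj => hi (h i₀ j i j _ hl.1 hj hl.2 hj).1⟩
    exact this ▸ hl.2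
  have hq := ProjectivePlane.one_lt_order P L
  obtain ⟨j₀, j₁, hj⟩ := Fintype.exists_pair_of_one_lt_card (hβ.symm ▸ hq : 1 < Fintype.card β)
  have hline : ∀ {j j'}, j ≠ j' → ∀ {ℓ : L}, b j ∈ ℓ → b j' ∈ ℓ → ∀ i, a i ∉ ℓ :=
    fun hne _ h₁ h₂ i hi => hne (h i _ i _ _ hi h₁ hi h₂).2
  have hm := mkLine_ax (L := L) (hb.ne hj)
  set m : L := mkLine (hb.ne hj)
  refine ⟨r, m, fun i => ⟨har i, hline hj hm.1 hm.2 i⟩, fun j => ⟨?_, hbr j⟩⟩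
  by_contra hjm
  have h0 : j₀ ≠ j := fun e => hjm (e ▸ hm.1)
  have h1 : j₁ ≠ j := fun e => hjm (e ▸ hm.2)
  have hk := mkLine_ax (L := L) (hb.ne h0)
  have hl := mkLine_ax (L := L) (hb.ne h1)
  set k : L := mkLine (hb.ne h0)
  set l : L := mkLine (hb.ne h1)
  have meet : ∀ {j} {ℓ : L}, b j ∈ ℓ → ∃ x : P, x ∈ ℓ ∧ x ∈ r := fun {j ℓ} hj =>
    have hne : ℓ ≠ r := fun e => hbr j (e ▸ hj)
    ⟨mkPoint hne, mkPoint_ax hne⟩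
  obtain ⟨x, hxm, hxr⟩ := meet hm.1
  obtain ⟨y, hyk, hyr⟩ := meet hk.1
  obtain ⟨z, hzl, hzr⟩ := meet hl.1
  have hxy : x ≠ y := by
    rintro rfl
    have : m = k := line_eq_of_mem (ne_of_mem_of_not_mem hxr (hbr j₀)) hxm hm.1 hyk hk.1
    exact hjm (this ▸ hk.2)
  have hxz : x ≠ z := by
    rintro rfl
    have : m = l := line_eq_of_mem (ne_of_mem_of_not_mem hxr (hbr j₁)) hxm hm.2 hzl hl.1
    exact hjm (this ▸ hl.2)
  have hyz : y ≠ z := by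
    rintro rfl
    have : k = l := line_eq_of_mem (ne_of_mem_of_not_mem hyr (hbr j)) hyk hk.2 hzl hl.2
    have : m = k := line_eq_of_mem (hb.ne hj) hm.1 hm.2 hk.1 (this ▸ hl.1)
    exact hjm (this ▸ hk.2)
  have hcard : ((Finset.univ.filter fun p : P => p ∈ r) \ Finset.univ.image a).card = 2 := by
    rw [Finset.card_sdiff_of_subset, card_filter_mem_line, Finset.card_image_of_injective _ ha,
      Finset.card_univ]
    · omega
    · intro p
      simp only [Finset.mem_image, Finset.mem_univ, true_and, Finset.mem_filter]
      rintro ⟨i, rfl⟩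
      exact har i
  have hsub : ({x, y, z} : Finset P) ⊆
      (Finset.univ.filter fun p : P => p ∈ r) \ Finset.univ.image a := by
    intro p hp
    simp only [Finset.mem_insert, Finset.mem_singleton] at hp
    simp only [Finset.mem_sdiff, Finset.mem_image, Finset.mem_univ, true_and, Finset.mem_filter,
      not_exists]
    rcases hp with rfl | rfl | rfl
    · exact ⟨hxr, fun i e => hline hj hm.1 hm.2 i (e ▸ hxm)⟩
    · exact ⟨hyr, fun i e => hline h0 hk.1 hk.2 i (e ▸ hyk)⟩
    · exact ⟨hzr, fun i e => hline h1 hl.1 hl.2 i (e ▸ hzl)⟩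
  have := Finset.card_le_card hsub
  rw [Finset.card_eq_three.mpr ⟨x, y, z, hxy, hxz, hyz, rfl⟩, hcard] at this
  omega

variable (P L) in
/-- Two distinct lines `r, m`, with injective placements of `α` on `r \ m` and of `β` on `m \ r`. -/
abbrev TwoLinePlacement (α β : Type*) : Type _ :=
  Σ p : {p : L × L // p.1 ≠ p.2},
    (α ↪ {x : P // x ∈ p.1.1 ∧ x ∉ p.1.2}) × (β ↪ {x : P // x ∈ p.1.2 ∧ x ∉ p.1.1})

/-- The vertex map underlying a placement. -/
def TwoLinePlacement.toFun {α β : Type*} (t : TwoLinePlacement P L α β) : α ⊕ β → P :=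
  Sum.elim (fun i => t.2.1 i) (fun j => t.2.2 j)

theorem TwoLinePlacement.toFun_injective {α β : Type*} [Fintype β] [Nonempty α]
    (hβ : Fintype.card β = ProjectivePlane.order P L) :
    Function.Injective (toFun : TwoLinePlacement P L α β → α ⊕ β → P) := by
  classical
  rintro ⟨⟨⟨r, m⟩, hrm⟩, f, g⟩ ⟨⟨⟨r', m'⟩, hrm'⟩, f', g'⟩ e
  dsimp only at hrm hrm' f g f' g'
  have hf : ∀ i, (f i : P) = f' i := fun i => congrFun e (.inl i)
  have hg : ∀ j, (g j : P) = g' j := fun j => congrFun e (.inr j)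
  have hq := ProjectivePlane.one_lt_order P L
  obtain ⟨j₀, j₁, hj⟩ := Fintype.exists_pair_of_one_lt_card (hβ.symm ▸ hq : 1 < Fintype.card β)
  obtain rfl : m = m' := by
    refine line_eq_of_mem (fun e => hj (g.injective (Subtype.ext e))) (g j₀).2.1 (g j₁).2.1 ?_ ?_
    · rw [hg]; exact (g' j₀).2.1
    · rw [hg]; exact (g' j₁).2.1
  obtain rfl : r = r' := by
    obtain ⟨i⟩ := ‹Nonempty α›
    have hz := mkPoint_ax (P := P) hrm
    set z : P := mkPoint hrm
    have hzr' : z ∈ r' := by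
      by_contra hzr'
      have hsurj : Function.Surjective g' :=
        ((Fintype.bijective_iff_injective_and_card g').2 ⟨g'.injective, by
          rw [hβ, ← Nat.card_eq_fintype_card, card_mem_notMem hrm'.symm]⟩).2
      obtain ⟨j, hjz⟩ := hsurj ⟨z, hz.2, hzr'⟩
      have : (g j : P) = z := by rw [hg, hjz]
      exact (g j).2.2 (this ▸ hz.1)
    refine line_eq_of_mem (ne_of_mem_of_not_mem hz.2 (f i).2.2).symm (f i).2.1 hz.1 ?_ hzr'
    rw [hf]; exact (f' i).2.1
  obtain rfl : f = f' := DFunLike.ext _ _ fun i => Subtype.ext (hf i)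
  obtain rfl : g = g' := DFunLike.ext _ _ fun j => Subtype.ext (hg j)
  rfl

theorem TwoLinePlacement.range_toFun {α β : Type*} [Fintype α] [Fintype β] [Nonempty α]
    (hα : Fintype.card α + 1 = ProjectivePlane.order P L)
    (hβ : Fintype.card β = ProjectivePlane.order P L) :
    Set.range (toFun : TwoLinePlacement P L α β → α ⊕ β → P) =
      {φ | IsGraphEmbedding (completeBipartiteGraph α β) P L φ} := by
  ext φ
  rw [Set.mem_ofPred_eq, isGraphEmbedding_completeBipartiteGraph_iff]
  constructor
  · rintro ⟨⟨⟨⟨r, m⟩, hrm⟩, f, g⟩, rfl⟩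
    dsimp only at hrm f g
    have hfg : ∀ i j, (f i : P) ≠ g j := fun i j e => (f i).2.2 (e ▸ (g j).2.1)
    refine ⟨(Subtype.val_injective.comp f.injective).sumElim
      (Subtype.val_injective.comp g.injective) hfg, ?_⟩
    intro i j i' j' ℓ h₁ h₂ h₃ h₄
    dsimp only [toFun, Sum.elim_inl, Sum.elim_inr] at h₁ h₂ h₃ h₄
    constructor
    · by_contra hi
      have : ℓ = r := line_eq_of_mem (fun e => hi (f.injective (Subtype.ext e))) h₁ h₃
        (f i).2.1 (f i').2.1
      exact (g j).2.2 (this ▸ h₂)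
    · by_contra hi
      have : ℓ = m := line_eq_of_mem (fun e => hi (g.injective (Subtype.ext e))) h₂ h₄
        (g j).2.1 (g j').2.1
      exact (f i).2.2 (this ▸ h₁)
  · rintro ⟨hφ, h⟩
    have ha := hφ.comp Sum.inl_injective
    have hb := hφ.comp Sum.inr_injective
    obtain ⟨r, m, hr, hm⟩ := exists_lines_of_embedding hα hβ ha hb
      (fun i j => hφ.ne Sum.inl_ne_inr) h
    obtain ⟨i⟩ := ‹Nonempty α›
    refine ⟨⟨⟨(r, m), fun e => (hr i).2 ((show r = m from e) ▸ (hr i).1)⟩,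
      ⟨fun i => ⟨_, hr i⟩, fun i i' e => ha (congrArg Subtype.val e)⟩,
      ⟨fun j => ⟨_, hm j⟩, fun j j' e => hb (congrArg Subtype.val e)⟩⟩, ?_⟩
    ext (i | j) <;> rfl

theorem card_twoLinePlacement {α β : Type*} [Fintype α] [Fintype β] :
    Nat.card (TwoLinePlacement P L α β) =
      (ProjectivePlane.order P L ^ 2 + ProjectivePlane.order P L + 1) *
        (ProjectivePlane.order P L ^ 2 + ProjectivePlane.order P L) *
          ((ProjectivePlane.order P L).descFactorial (Fintype.card α) *
            (ProjectivePlane.order P L).descFactorial (Fintype.card β)) := by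
  classical
  have hpairs : Fintype.card {p : L × L // p.1 ≠ p.2} =
      (ProjectivePlane.order P L ^ 2 + ProjectivePlane.order P L + 1) *
        (ProjectivePlane.order P L ^ 2 + ProjectivePlane.order P L) := by
    have : (Finset.univ.filter fun p : L × L => p.1 ≠ p.2) = (Finset.univ : Finset L).offDiag := by
      ext p
      simp
    rw [Fintype.card_subtype, this, Finset.offDiag_card, Finset.card_univ,
      ProjectivePlane.card_lines P L, ← Nat.mul_sub_one, Nat.add_sub_cancel]
  rw [Nat.card_sigma, ← hpairs, ← smul_eq_mul, ← Finset.card_univ, ← Finset.sum_const]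
  refine Finset.sum_congr rfl fun p _ => ?_
  have h₁ := card_mem_notMem (P := P) p.2
  have h₂ := card_mem_notMem (P := P) p.2.symm
  rw [Nat.card_eq_fintype_card] at h₁ h₂
  rw [Nat.card_prod, Nat.card_eq_fintype_card, Nat.card_eq_fintype_card,
    Fintype.card_embedding_eq, Fintype.card_embedding_eq, h₁, h₂]

end Counting

/-- The number of embeddings of `K_{q-1,q}` into a finite projective plane of order `q ≥ 2`
equals `q²(q+1)(q²+q+1) · (q-1)! · q!`. -/
theorem count_Kqm1q_embeddings {P L : Type*} [Fintype P] [Fintype L]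
    [Membership P L] [Configuration.ProjectivePlane P L] (q : ℕ) (hq2 : 2 ≤ q)
    (hq : Configuration.ProjectivePlane.order P L = q) :
    Set.ncard {φ : Fin (q - 1) ⊕ Fin q → P |
        IsGraphEmbedding (completeBipartiteGraph (Fin (q - 1)) (Fin q)) P L φ} =
      q ^ 2 * (q + 1) * (q ^ 2 + q + 1) * (q - 1).factorial * q.factorial := by
  obtain ⟨n, rfl⟩ : ∃ n, q = n + 1 := ⟨q - 1, by omega⟩
  have : Nonempty (Fin (n + 1 - 1)) := ⟨⟨0, by omega⟩⟩
  have hα : Fintype.card (Fin (n + 1 - 1)) + 1 = Configuration.ProjectivePlane.order P L := by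
    simp [hq]
  have hβ : Fintype.card (Fin (n + 1)) = Configuration.ProjectivePlane.order P L := by
    simp [hq]
  rw [← TwoLinePlacement.range_toFun hα hβ, ← Nat.card_coe_set_eq,
    Nat.card_range_of_injective (TwoLinePlacement.toFun_injective hβ), card_twoLinePlacement, hq]
  have hdesc : (n + 1).descFactorial n = (n + 1) * n.factorial := by
    have := Nat.factorial_mul_descFactorial (Nat.le_succ n)
    simpa [Nat.factorial_succ] using this
  simp only [Fintype.card_fin, Nat.add_sub_cancel, Nat.descFactorial_self, hdesc]
  ring
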